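/- Let F and C be nonempty finite multisets of real numbers with means m_F = (Σ F)/|F| and m_C = (Σ C)/|C| satisfying m_C = m_F + k for some k > 0. Let F' = F + C be the merged multiset, and let L be a sub-multiset of F' with |L| = l, where l < |F| + |C| and every element of L is at most m_F. Then the multiset F' − L is nonempty and its mean satisfies (Σ(F' − L))/(|F'| − l) ≥ m_F + (|C|·k)/(|F| + |C| − l). -/

import Mathlib

theorem stmt_1 (F C L : Multiset ℝ) (hF : F ≠ 0) (hC : C ≠ 0) (k : ℝ) (hk : 0 < k)
    (mF mC : ℝ) (hmF : mF = F.sum / (F.card : ℝ)) (hmC : mC = C.sum / (C.card : ℝ))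
    (hFC : mC = mF + k)
    (hL : L ≤ F + C) (l : ℕ) (hl : L.card = l) (hlt : l < F.card + C.card)
    (hLle : ∀ x ∈ L, x ≤ mF) :
    F + C - L ≠ 0 ∧
      (F + C - L).sum / (((F.card : ℝ) + (C.card : ℝ)) - (l : ℝ)) ≥
        mF + ((C.card : ℝ) * k) / (((F.card : ℝ) + (C.card : ℝ)) - (l : ℝ)) := by
  have hsplit : F + C - L + L = F + C := Multiset.sub_add_cancel hL
  constructor
  · intro h
    have hcard := congrArg Multiset.card hsplit
    simp only [h, zero_add, Multiset.card_add] at hcard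
    omega
  · have hsum := congrArg Multiset.sum hsplit
    simp only [Multiset.sum_add] at hsum
    have hF0 : (F.card : ℝ) ≠ 0 := by simpa using hF
    have hC0 : (C.card : ℝ) ≠ 0 := by simpa using hC
    have hFsum : F.sum = mF * F.card := by rw [hmF, div_mul_cancel₀ _ hF0]
    have hCsum : C.sum = (mF + k) * C.card := by rw [← hFC, hmC, div_mul_cancel₀ _ hC0]
    have hLsum : L.sum ≤ l * mF := by
      simpa [hl] using Multiset.sum_le_card_nsmul L mF hLle
    have hpos : (0 : ℝ) < (F.card : ℝ) + C.card - l := by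
      rw [sub_pos]
      exact_mod_cast hlt
    rw [ge_iff_le, le_div_iff₀ hpos, add_mul, div_mul_cancel₀ _ hpos.ne']
    linarith
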